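/- Suppose in addition φ'(u) = −sin φ(u)/f(u) for all u ∈ I (the surface is minimal, H = 0), let μ ≠ 0 with 1 − μφ'(u) ≠ 0 and 1 + μφ'(u) ≠ 0 on I, and set x* := x + μN. Then the sum of the principal radii of curvature of the parallel surface x*, namely ‖∂x*/∂u‖²/(−⟨∂x*/∂u, ∂N/∂u⟩) + ‖∂x*/∂v‖²/(−⟨∂x*/∂v, ∂N/∂v⟩), is the constant −2μ at every point of I × ℝ. (Forward direction of Theorem 2: a parallel surface of a minimal surface has constant sum of principal radii of curvature.) -/

import Mathlib

open Real

/-- The surface of revolution `x(u,v) = (f(u) cos v, f(u) sin v, g(u))`. -/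
noncomputable def xMap (f g : ℝ → ℝ) (u v : ℝ) : ℝ × ℝ × ℝ :=
  (f u * Real.cos v, f u * Real.sin v, g u)

/-- The Gauss map `N(u,v) = (−sin φ(u) cos v, −sin φ(u) sin v, cos φ(u))`. -/
noncomputable def nMap (φ : ℝ → ℝ) (u v : ℝ) : ℝ × ℝ × ℝ :=
  (-(Real.sin (φ u)) * Real.cos v, -(Real.sin (φ u)) * Real.sin v, Real.cos (φ u))

/-- The Euclidean inner product on `ℝ³`. -/
def dot3 (p q : ℝ × ℝ × ℝ) : ℝ := p.1 * q.1 + p.2.1 * q.2.1 + p.2.2 * q.2.2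

/-- The parallel surface `x* = x + μN`. -/
noncomputable def pStar (φ f g : ℝ → ℝ) (μ : ℝ) (u v : ℝ) : ℝ × ℝ × ℝ :=
  xMap f g u v + μ • nMap φ u v

theorem dot3_smul_smul (c d : ℝ) (p q : ℝ × ℝ × ℝ) :
    dot3 (c • p) (d • q) = c * d * dot3 p q := by
  simp only [dot3, Prod.smul_fst, Prod.smul_snd, smul_eq_mul]
  ring

/-- If `N' = d • x'` (Rodrigues' formula for the principal curvature `-d`), then the principal
radius of curvature of `x + μN` in this direction is that of `x`, shifted by `-μ`. -/
theorem radius_parallel_of_hasDerivAt {X N : ℝ → ℝ × ℝ × ℝ} {w : ℝ × ℝ × ℝ} {d μ t : ℝ}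
    (hX : HasDerivAt X w t) (hN : HasDerivAt N (d • w) t) (hw : dot3 w w ≠ 0)
    (hd : d ≠ 0) :
    dot3 (deriv (fun s => X s + μ • N s) t) (deriv (fun s => X s + μ • N s) t)
        / (-dot3 (deriv (fun s => X s + μ • N s) t) (deriv N t)) = -d⁻¹ - μ := by
  have hP : HasDerivAt (fun s => X s + μ • N s) ((1 + μ * d) • w) t := by
    refine (hX.add (hN.const_smul μ)).congr_deriv ?_
    rw [add_smul, one_smul, mul_smul]
  rw [hP.deriv, hN.deriv, dot3_smul_smul, dot3_smul_smul]
  field_simp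
  ring

theorem hasDerivAt_xMap_left {f g : ℝ → ℝ} {f' g' u : ℝ} (hf : HasDerivAt f f' u)
    (hg : HasDerivAt g g' u) (v : ℝ) :
    HasDerivAt (fun t => xMap f g t v) (f' * Real.cos v, f' * Real.sin v, g') u :=
  (hf.mul_const _).prodMk ((hf.mul_const _).prodMk hg)

theorem hasDerivAt_nMap_left {φ : ℝ → ℝ} {k u : ℝ} (hφ : HasDerivAt φ k u) (v : ℝ) :
    HasDerivAt (fun t => nMap φ t v)
      ((-k) • (Real.cos (φ u) * Real.cos v, Real.cos (φ u) * Real.sin v, Real.sin (φ u))) u := by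
  refine ((hφ.sin.neg.mul_const (Real.cos v)).prodMk
    ((hφ.sin.neg.mul_const (Real.sin v)).prodMk hφ.cos)).congr_deriv ?_
  ext <;> simp only [Prod.smul_mk, smul_eq_mul] <;> ring

theorem hasDerivAt_xMap_right (f g : ℝ → ℝ) (u v : ℝ) :
    HasDerivAt (fun t => xMap f g u t) (f u * -Real.sin v, f u * Real.cos v, 0) v :=
  ((Real.hasDerivAt_cos v).const_mul _).prodMk
    (((Real.hasDerivAt_sin v).const_mul _).prodMk (hasDerivAt_const v _))

theorem hasDerivAt_nMap_right (φ : ℝ → ℝ) (u v : ℝ) :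
    HasDerivAt (fun t => nMap φ u t)
      (-(Real.sin (φ u)) * -Real.sin v, -(Real.sin (φ u)) * Real.cos v, 0) v :=
  ((Real.hasDerivAt_cos v).const_mul _).prodMk
    (((Real.hasDerivAt_sin v).const_mul _).prodMk (hasDerivAt_const v _))

/-- Theorem 2, forward direction: a parallel surface of a minimal surface
of revolution has constant sum of principal radii of curvature, equal to −2μ. -/
theorem parallel_of_minimal_has_constant_R
    (a b : ℝ) (φ f g : ℝ → ℝ)
    (hφ : ContDiff ℝ (⊤ : ℕ∞) φ) (hf : ContDiff ℝ (⊤ : ℕ∞) f) (hg : ContDiff ℝ (⊤ : ℕ∞) g)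
    (hfd : ∀ u ∈ Set.Ioo a b, deriv f u = Real.cos (φ u))
    (hgd : ∀ u ∈ Set.Ioo a b, deriv g u = Real.sin (φ u))
    (hfpos : ∀ u ∈ Set.Ioo a b, 0 < f u)
    (hsin : ∀ u ∈ Set.Ioo a b, Real.sin (φ u) ≠ 0)
    (hφd : ∀ u ∈ Set.Ioo a b, deriv φ u ≠ 0)
    (hmin : ∀ u ∈ Set.Ioo a b, deriv φ u = -(Real.sin (φ u)) / f u)
    (μ : ℝ) (hμ : μ ≠ 0)
    (hμ1 : ∀ u ∈ Set.Ioo a b, 1 - μ * deriv φ u ≠ 0)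
    (hμ2 : ∀ u ∈ Set.Ioo a b, 1 + μ * deriv φ u ≠ 0) :
    ∀ u ∈ Set.Ioo a b, ∀ v : ℝ,
      dot3 (deriv (fun t => pStar φ f g μ t v) u) (deriv (fun t => pStar φ f g μ t v) u)
            / (-dot3 (deriv (fun t => pStar φ f g μ t v) u) (deriv (fun t => nMap φ t v) u))
          + dot3 (deriv (fun t => pStar φ f g μ u t) v)
                (deriv (fun t => pStar φ f g μ u t) v)
            / (-dot3 (deriv (fun t => pStar φ f g μ u t) v) (deriv (fun t => nMap φ u t) v))
        = -2 * μ := by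
  intro u hu v
  have hk := hφd u hu
  have hf0 := (hfpos u hu).ne'
  have hF : HasDerivAt f (Real.cos (φ u)) u :=
    hfd u hu ▸ (hf.differentiable (by simp) u).hasDerivAt
  have hG : HasDerivAt g (Real.sin (φ u)) u :=
    hgd u hu ▸ (hg.differentiable (by simp) u).hasDerivAt
  have hΦ : HasDerivAt φ (deriv φ u) u := (hφ.differentiable (by simp) u).hasDerivAt
  have hs : -(Real.sin (φ u)) = deriv φ u * f u := by
    rw [hmin u hu, div_mul_cancel₀ _ hf0]
  have hNv : HasDerivAt (fun t => nMap φ u t)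
      (deriv φ u • (f u * -Real.sin v, f u * Real.cos v, (0 : ℝ))) v := by
    refine (hasDerivAt_nMap_right φ u v).congr_deriv ?_
    ext <;> simp only [Prod.smul_mk, smul_eq_mul, hs] <;> ring
  have hwu : dot3 (Real.cos (φ u) * Real.cos v, Real.cos (φ u) * Real.sin v, Real.sin (φ u))
      (Real.cos (φ u) * Real.cos v, Real.cos (φ u) * Real.sin v, Real.sin (φ u)) = 1 := by
    simp only [dot3]
    linear_combination Real.cos (φ u) ^ 2 * Real.sin_sq_add_cos_sq v +
      Real.sin_sq_add_cos_sq (φ u)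
  have hwv : dot3 (f u * -Real.sin v, f u * Real.cos v, 0)
      (f u * -Real.sin v, f u * Real.cos v, 0) = f u ^ 2 := by
    simp only [dot3]
    linear_combination f u ^ 2 * Real.sin_sq_add_cos_sq v
  have hRu := radius_parallel_of_hasDerivAt (μ := μ) (hasDerivAt_xMap_left hF hG v)
    (hasDerivAt_nMap_left hΦ v) (hwu ▸ one_ne_zero) (neg_ne_zero.mpr hk)
  have hRv := radius_parallel_of_hasDerivAt (μ := μ) (hasDerivAt_xMap_right f g u v) hNv
    (hwv ▸ pow_ne_zero 2 hf0) hk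
  simp only [pStar]
  rw [hRu, hRv, inv_neg]
  ring
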